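/- arXiv:0901.4414 — 6 statements merged into one kernel-verified Lean document; each statement's English description precedes it below -/
import Mathlib

section
/- Let d ≥ 2, ρ > 0, and let b : ℝ^d → L(ℝ^d, ℝ^d) be a continuous map satisfying b(x) = Oᵀ ∘ b(Ox) ∘ O for every orthogonal linear map O of ℝ^d. Then the function θ ↦ ∫_{S^{d-1}} ⟨b(ρφ − ρθ)φ, θ⟩ dσ(φ) is constant on the unit sphere S^{d-1}. -/
open MeasureTheory RealInnerProductSpace

/-- If `f` is invariant under the diagonal action of the isometries and so is `μ`, then
`θ ↦ ∫ φ, f φ θ ∂μ` is invariant too. -/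
theorem integral_apply_linearIsometryEquiv {E : Type*} [NormedAddCommGroup E] [NormedSpace ℝ E]
    [MeasurableSpace E] [BorelSpace E] {μ : Measure E} (O : E ≃ₗᵢ[ℝ] E)
    (hμ : Measure.map (⇑O) μ = μ) {f : E → E → ℝ} (hf : ∀ φ θ, f (O φ) (O θ) = f φ θ) (θ : E) :
    ∫ φ, f φ (O θ) ∂μ = ∫ φ, f φ θ ∂μ := by
  have h := O.toHomeomorph.measurableEmbedding.integral_map (μ := μ) (fun φ => f φ (O θ))
  rw [LinearIsometryEquiv.coe_toHomeomorph, hμ] at h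
  simpa only [hf] using h

/-- Let `σ` be the uniform (rotation-invariant) probability measure on the
unit sphere of `ℝ^d` (realized as a rotation-invariant Borel probability measure on `ℝ^d`
concentrated on the unit sphere). Let `ρ > 0` and let `b : ℝ^d → L(ℝ^d, ℝ^d)` be continuous
with `b(x) = Oᵀ ∘ b(Ox) ∘ O` for every orthogonal map `O` (i.e. `b x v = O⁻¹ (b (O x) (O v))`,
since `Oᵀ = O⁻¹` for orthogonal `O`). Then `θ ↦ ∫ ⟪b(ρφ − ρθ)φ, θ⟫ dσ(φ)` is constant on the
unit sphere. -/
theorem statement3 (d : ℕ) (hd : 2 ≤ d)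
    (σ : Measure (EuclideanSpace ℝ (Fin d))) [IsProbabilityMeasure σ]
    (hσsphere : σ (Metric.sphere (0 : EuclideanSpace ℝ (Fin d)) 1)ᶜ = 0)
    (hσinv : ∀ O : EuclideanSpace ℝ (Fin d) ≃ₗᵢ[ℝ] EuclideanSpace ℝ (Fin d),
      Measure.map (⇑O) σ = σ)
    (ρ : ℝ) (hρ : 0 < ρ)
    (b : EuclideanSpace ℝ (Fin d) →
      (EuclideanSpace ℝ (Fin d) →L[ℝ] EuclideanSpace ℝ (Fin d)))
    (hb : Continuous b)
    (hiso : ∀ (O : EuclideanSpace ℝ (Fin d) ≃ₗᵢ[ℝ] EuclideanSpace ℝ (Fin d))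
      (x v : EuclideanSpace ℝ (Fin d)), b x v = O.symm (b (O x) (O v))) :
    ∃ c : ℝ, ∀ θ ∈ Metric.sphere (0 : EuclideanSpace ℝ (Fin d)) 1,
      ∫ φ, ⟪b (ρ • φ - ρ • θ) φ, θ⟫ ∂σ = c := by
  set f : EuclideanSpace ℝ (Fin d) → EuclideanSpace ℝ (Fin d) → ℝ :=
    fun φ θ => ⟪b (ρ • φ - ρ • θ) φ, θ⟫
  have hf : ∀ (O : EuclideanSpace ℝ (Fin d) ≃ₗᵢ[ℝ] EuclideanSpace ℝ (Fin d)) (φ θ),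
      f (O φ) (O θ) = f φ θ := by
    intro O φ θ
    simp only [f]
    rw [hiso O (ρ • φ - ρ • θ) φ, ← O.inner_map_map (O.symm _) θ, O.apply_symm_apply,
      map_sub, map_smul, map_smul]
  let e : EuclideanSpace ℝ (Fin d) := EuclideanSpace.single ⟨0, by omega⟩ 1
  refine ⟨∫ φ, f φ e ∂σ, fun θ hθ => ?_⟩
  have hnorm : ‖e‖ = ‖θ‖ := by
    rw [mem_sphere_zero_iff_norm.mp hθ]
    simp [e]
  have h := integral_apply_linearIsometryEquiv _ (hσinv (ℝ ∙ (e - θ))ᗮ.reflection) (hf _) e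
  rwa [Submodule.reflection_sub hnorm] at h
end

section
/- Let ρ > 0 and suppose the kernel of the RKHS (H, ι, k) is translation invariant with covariance tensor b, and that b is isotropic. If ∫_{S^{d-1}} ∫_{S^{d-1}} ⟨b(ρθ − ρφ)θ, φ⟩ dσ(θ) dσ(φ) > 0, then there exists V ∈ H such that ⟨(ι V)(ρθ), θ⟩ < 0 for every θ ∈ S^{d-1}; indeed V can be chosen so that the function θ ↦ ⟨(ι V)(ρθ), θ⟩ is equal to a strictly negative constant on S^{d-1}. -/
open MeasureTheory RealInnerProductSpace

/-- An average against an isometry-invariant measure of a kernel invariant under isometries is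
constant along orbits of isometries. -/
lemma integral_comp_linearIsometryEquiv_eq {E : Type*} [NormedAddCommGroup E] [NormedSpace ℝ E]
    [MeasurableSpace E] [BorelSpace E] {σ : Measure E} (O : E ≃ₗᵢ[ℝ] E)
    (hσ : Measure.map (⇑O) σ = σ) {F : E → E → ℝ} (hF : ∀ x y, F (O x) (O y) = F x y) (y : E) :
    ∫ x, F x (O y) ∂σ = ∫ x, F x y ∂σ := by
  have hmp : MeasurePreserving (⇑O) σ σ := ⟨O.continuous.measurable, hσ⟩
  rw [← hmp.integral_comp O.toHomeomorph.measurableEmbedding fun x => F x (O y)]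
  simp only [hF]

/-- Vectors of equal norm are related by a linear isometry. -/
lemma exists_linearIsometryEquiv_apply_eq {E : Type*} [NormedAddCommGroup E]
    [InnerProductSpace ℝ E] {v w : E} (h : ‖v‖ = ‖w‖) : ∃ O : E ≃ₗᵢ[ℝ] E, O v = w :=
  ⟨_, Submodule.reflection_sub h⟩

/-- A continuous function is integrable for a finite measure carried by a compact set. -/
lemma Continuous.integrable_of_compl_null {E H : Type*} [TopologicalSpace E]
    [SecondCountableTopology E] [MeasurableSpace E] [OpensMeasurableSpace E]
    [NormedAddCommGroup H] {σ : Measure E} [IsFiniteMeasure σ]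
    {s : Set E} (hs : IsCompact s) (hσ : σ sᶜ = 0) {f : E → H} (hf : Continuous f) :
    Integrable f σ := by
  obtain ⟨C, hC⟩ := hs.exists_bound_of_continuousOn hf.continuousOn
  refine Integrable.of_bound hf.aestronglyMeasurable C ?_
  filter_upwards [compl_mem_ae_iff.mpr hσ] with x hx
  exact hC x (by simpa using hx)

/-- Let `σ` be the uniform (rotation-invariant) probability measure on the
unit sphere of `ℝ^d`, and let `(H, ι, k)` be an RKHS of vector fields on `ℝ^d` whose kernel is
translation invariant with covariance tensor `b` (`(ι k(x,ξ))(y) = b(x−y)ξ`), `b` isotropic.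
If `∫∫ ⟪b(ρθ − ρφ)θ, φ⟫ dσ(θ) dσ(φ) > 0` then there exists `V ∈ H` with
`⟪(ι V)(ρθ), θ⟫ < 0` for every unit vector `θ`; indeed `V` can be chosen so that
`θ ↦ ⟪(ι V)(ρθ), θ⟫` equals a strictly negative constant on the sphere. -/
theorem statement4 (d : ℕ) (hd : 2 ≤ d)
    (σ : Measure (EuclideanSpace ℝ (Fin d))) [IsProbabilityMeasure σ]
    (hσsphere : σ (Metric.sphere (0 : EuclideanSpace ℝ (Fin d)) 1)ᶜ = 0)
    (hσinv : ∀ O : EuclideanSpace ℝ (Fin d) ≃ₗᵢ[ℝ] EuclideanSpace ℝ (Fin d),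
      Measure.map (⇑O) σ = σ)
    (H : Type*) [NormedAddCommGroup H] [InnerProductSpace ℝ H] [CompleteSpace H]
    (ι : H →ₗ[ℝ] (EuclideanSpace ℝ (Fin d) → EuclideanSpace ℝ (Fin d)))
    (hι : Function.Injective ι)
    (k : EuclideanSpace ℝ (Fin d) → EuclideanSpace ℝ (Fin d) → H)
    (hk : Continuous fun p : EuclideanSpace ℝ (Fin d) × EuclideanSpace ℝ (Fin d) =>
      k p.1 p.2)
    (hrep : ∀ (f : H) (x ξ : EuclideanSpace ℝ (Fin d)), ⟪f, k x ξ⟫ = ⟪ι f x, ξ⟫)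
    (b : EuclideanSpace ℝ (Fin d) →
      (EuclideanSpace ℝ (Fin d) →L[ℝ] EuclideanSpace ℝ (Fin d)))
    (hbcont : Continuous b)
    (htransl : ∀ x ξ y : EuclideanSpace ℝ (Fin d), ι (k x ξ) y = b (x - y) ξ)
    (hiso : ∀ (O : EuclideanSpace ℝ (Fin d) ≃ₗᵢ[ℝ] EuclideanSpace ℝ (Fin d))
      (x v : EuclideanSpace ℝ (Fin d)), b x v = O.symm (b (O x) (O v)))
    (ρ : ℝ) (hρ : 0 < ρ)
    (hpos : 0 < ∫ φ, ∫ θ, ⟪b (ρ • θ - ρ • φ) θ, φ⟫ ∂σ ∂σ) :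
    ∃ V : H, (∀ θ ∈ Metric.sphere (0 : EuclideanSpace ℝ (Fin d)) 1,
        ⟪ι V (ρ • θ), θ⟫ < 0) ∧
      ∃ c : ℝ, c < 0 ∧ ∀ θ ∈ Metric.sphere (0 : EuclideanSpace ℝ (Fin d)) 1,
        ⟪ι V (ρ • θ), θ⟫ = c := by
  have hsphere : ∀ᵐ θ ∂σ, θ ∈ Metric.sphere (0 : EuclideanSpace ℝ (Fin d)) 1 := hσsphere
  have hkint : Integrable (fun θ => k (ρ • θ) θ) σ :=
    Continuous.integrable_of_compl_null (isCompact_sphere _ _) hσsphere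
      (hk.comp ((continuous_id.const_smul ρ).prodMk continuous_id))
  set g : EuclideanSpace ℝ (Fin d) → ℝ := fun φ => ∫ θ, ⟪b (ρ • θ - ρ • φ) θ, φ⟫ ∂σ
  have hgV (φ : EuclideanSpace ℝ (Fin d)) :
      ⟪ι (-∫ θ, k (ρ • θ) θ ∂σ) (ρ • φ), φ⟫ = -g φ := by
    rw [← hrep, inner_neg_left, real_inner_comm, ← integral_inner hkint]
    congr 2 with θ
    rw [real_inner_comm, hrep, htransl]
  have hginv (O : EuclideanSpace ℝ (Fin d) ≃ₗᵢ[ℝ] EuclideanSpace ℝ (Fin d))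
      (φ : EuclideanSpace ℝ (Fin d)) : g (O φ) = g φ := by
    refine integral_comp_linearIsometryEquiv_eq O (hσinv O)
      (F := fun θ φ => ⟪b (ρ • θ - ρ • φ) θ, φ⟫) (fun θ φ => ?_) φ
    rw [hiso O (ρ • θ - ρ • φ) θ, map_sub, map_smul, map_smul,
      ← O.inner_map_map (O.symm _), O.apply_symm_apply]
  obtain ⟨φ₀, hφ₀⟩ := hsphere.exists
  have hconst : ∀ φ ∈ Metric.sphere (0 : EuclideanSpace ℝ (Fin d)) 1, g φ = g φ₀ := by
    intro φ hφ
    obtain ⟨O, rfl⟩ := exists_linearIsometryEquiv_apply_eq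
      ((mem_sphere_zero_iff_norm.mp hφ₀).trans (mem_sphere_zero_iff_norm.mp hφ).symm)
    exact hginv O φ₀
  have hgpos : 0 < g φ₀ := by
    rw [integral_congr_ae (hsphere.mono hconst)] at hpos
    simpa using hpos
  have hV : ∀ φ ∈ Metric.sphere (0 : EuclideanSpace ℝ (Fin d)) 1,
      ⟪ι (-∫ θ, k (ρ • θ) θ ∂σ) (ρ • φ), φ⟫ = -g φ₀ := fun φ hφ => by
    rw [hgV, hconst φ hφ]
  exact ⟨_, fun φ hφ => by rw [hV φ hφ]; exact neg_neg_of_pos hgpos,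
    -g φ₀, neg_neg_of_pos hgpos, hV⟩
end

section
/- Let ρ > 0 and suppose the kernel of the RKHS (H, ι, k) is translation invariant with covariance tensor b. If ∫_{S^{d-1}} ∫_{S^{d-1}} ⟨b(ρθ − ρφ)θ, φ⟩ dσ(θ) dσ(φ) = 0, then ∫_{S^{d-1}} ⟨(ι V)(ρθ), θ⟩ dσ(θ) = 0 for every V ∈ H; in particular there is no V ∈ H with ⟨(ι V)(ρθ), θ⟩ < 0 for all θ ∈ S^{d-1}. -/
open MeasureTheory RealInnerProductSpace

/-- A continuous function is integrable against a finite measure carried by a compact set. -/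
theorem Continuous.integrable_of_compl_null_s5 {E F : Type*} [TopologicalSpace E] [T2Space E]
    [MeasurableSpace E] [OpensMeasurableSpace E] [TopologicalSpace.PseudoMetrizableSpace E]
    [NormedAddCommGroup F] {μ : Measure E} [IsFiniteMeasure μ] {K : Set E} (hK : IsCompact K)
    (hμ : μ Kᶜ = 0) {g : E → F} (hg : Continuous g) : Integrable g μ := by
  have h : IntegrableOn g K μ := hg.continuousOn.integrableOn_compact' hK hK.measurableSet
  rwa [IntegrableOn, Measure.restrict_eq_self_of_ae_mem (mem_ae_iff.mpr hμ)] at h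

/-- A Bochner integral whose Gram double integral vanishes is zero. -/
theorem integral_eq_zero_of_integral_integral_inner_eq_zero {E H : Type*} [MeasurableSpace E]
    [NormedAddCommGroup H] [InnerProductSpace ℝ H] [CompleteSpace H] {μ : Measure E} {g : E → H}
    (hg : Integrable g μ) (h : ∫ y, ∫ x, ⟪g x, g y⟫ ∂μ ∂μ = 0) : ∫ x, g x ∂μ = 0 := by
  refine inner_self_eq_zero (𝕜 := ℝ).mp ?_
  rw [← integral_inner hg, ← h]
  refine integral_congr_ae (.of_forall fun y => ?_)
  simp only [real_inner_comm (g y), ← integral_inner hg (g y)]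

/-- Let `σ` be the uniform (rotation-invariant) probability measure on the
unit sphere of `ℝ^d`, and let `(H, ι, k)` be an RKHS of vector fields on `ℝ^d` whose kernel is
translation invariant with covariance tensor `b`.  If
`∫∫ ⟪b(ρθ − ρφ)θ, φ⟫ dσ(θ) dσ(φ) = 0` then `∫ ⟪(ι V)(ρθ), θ⟫ dσ(θ) = 0` for every `V ∈ H`;
in particular there is no `V ∈ H` with `⟪(ι V)(ρθ), θ⟫ < 0` for all unit vectors `θ`. -/
theorem statement5 (d : ℕ) (hd : 2 ≤ d)
    (σ : Measure (EuclideanSpace ℝ (Fin d))) [IsProbabilityMeasure σ]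
    (hσsphere : σ (Metric.sphere (0 : EuclideanSpace ℝ (Fin d)) 1)ᶜ = 0)
    (hσinv : ∀ O : EuclideanSpace ℝ (Fin d) ≃ₗᵢ[ℝ] EuclideanSpace ℝ (Fin d),
      Measure.map (⇑O) σ = σ)
    (H : Type*) [NormedAddCommGroup H] [InnerProductSpace ℝ H] [CompleteSpace H]
    (ι : H →ₗ[ℝ] (EuclideanSpace ℝ (Fin d) → EuclideanSpace ℝ (Fin d)))
    (hι : Function.Injective ι)
    (k : EuclideanSpace ℝ (Fin d) → EuclideanSpace ℝ (Fin d) → H)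
    (hk : Continuous fun p : EuclideanSpace ℝ (Fin d) × EuclideanSpace ℝ (Fin d) =>
      k p.1 p.2)
    (hrep : ∀ (f : H) (x ξ : EuclideanSpace ℝ (Fin d)), ⟪f, k x ξ⟫ = ⟪ι f x, ξ⟫)
    (b : EuclideanSpace ℝ (Fin d) →
      (EuclideanSpace ℝ (Fin d) →L[ℝ] EuclideanSpace ℝ (Fin d)))
    (hbcont : Continuous b)
    (htransl : ∀ x ξ y : EuclideanSpace ℝ (Fin d), ι (k x ξ) y = b (x - y) ξ)
    (ρ : ℝ) (hρ : 0 < ρ)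
    (hzero : ∫ φ, ∫ θ, ⟪b (ρ • θ - ρ • φ) θ, φ⟫ ∂σ ∂σ = 0) :
    (∀ V : H, ∫ θ, ⟪ι V (ρ • θ), θ⟫ ∂σ = 0) ∧
    ¬ ∃ V : H, ∀ θ ∈ Metric.sphere (0 : EuclideanSpace ℝ (Fin d)) 1,
        ⟪ι V (ρ • θ), θ⟫ < 0 := by
  have hg : Continuous fun θ => k (ρ • θ) θ :=
    hk.comp ((continuous_const_smul ρ).prodMk continuous_id)
  have hgi : Integrable (fun θ => k (ρ • θ) θ) σ :=
    hg.integrable_of_compl_null_s5 (isCompact_sphere 0 1) hσsphere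
  have hmean : ∫ θ, k (ρ • θ) θ ∂σ = 0 := by
    refine integral_eq_zero_of_integral_integral_inner_eq_zero hgi ?_
    simpa only [hrep, htransl] using hzero
  have hV : ∀ V : H, ∫ θ, ⟪ι V (ρ • θ), θ⟫ ∂σ = 0 := fun V => by
    simp only [← hrep, integral_inner hgi V, hmean, inner_zero_right]
  refine ⟨hV, fun ⟨V, hneg⟩ => ?_⟩
  have hint : Integrable (fun θ => ⟪ι V (ρ • θ), θ⟫) σ := by
    simpa only [← hrep] using hgi.const_inner (𝕜 := ℝ) V
  have hae : ∀ᵐ θ ∂σ, ⟪ι V (ρ • θ), θ⟫ < 0 := by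
    filter_upwards [mem_ae_iff.mpr hσsphere] with θ hθ using hneg θ hθ
  have hzero_ae : (fun θ => -⟪ι V (ρ • θ), θ⟫) =ᵐ[σ] 0 := by
    refine (integral_eq_zero_iff_of_nonneg_ae ?_ hint.neg).mp (by rw [integral_neg', hV, neg_zero])
    filter_upwards [hae] with θ hθ using neg_nonneg.mpr hθ.le
  obtain ⟨θ, hlt, heq⟩ := (hae.and hzero_ae).exists
  exact hlt.ne (neg_eq_zero.mp heq)
end

section
/- Suppose the kernel of the RKHS (H, ι, k) is translation invariant with covariance tensor b, and suppose that for every V ∈ H the vector field ι V is continuously differentiable and divergence free on ℝ^d, i.e. trace(D(ι V)(x)) = 0 for all x ∈ ℝ^d. Then for every ρ > 0 one has ∫_{S^{d-1}} ∫_{S^{d-1}} ⟨b(ρθ − ρφ)θ, φ⟩ dσ(θ) dσ(φ) = 0. -/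
open MeasureTheory RealInnerProductSpace

section CompactSupport

variable {X G : Type*} [TopologicalSpace X] [T2Space X]
  [MeasurableSpace X] [BorelSpace X] [NormedAddCommGroup G]
  {μ : Measure X} [IsFiniteMeasure μ] {K : Set X}

theorem Continuous.integrable_of_isCompact_of_compl_null {f : X → G} (hK : IsCompact K)
    (hμ : μ Kᶜ = 0) (hf : Continuous f) : Integrable f μ := by
  rw [← Measure.restrict_eq_self_of_ae_mem (s := K) hμ]
  exact hf.continuousOn.integrableOn_compact hK

/-- Differentiation under the integral sign for a finite measure carried by a compact set. -/
theorem hasDerivAt_integral_of_isCompact_of_compl_null [SecondCountableTopology X]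
    [NormedSpace ℝ G] {f f' : ℝ → X → G} (hK : IsCompact K)
    (hμ : μ Kᶜ = 0) (hf : ∀ t, Continuous (f t))
    (hf' : Continuous fun p : ℝ × X => f' p.1 p.2)
    (hderiv : ∀ t x, HasDerivAt (fun s => f s x) (f' t x) t) (t : ℝ) :
    HasDerivAt (fun s => ∫ x, f s x ∂μ) (∫ x, f' t x ∂μ) t := by
  obtain ⟨C, hC⟩ := ((isCompact_closedBall t 1).prod hK).exists_bound_of_continuousOn
    hf'.continuousOn
  refine (hasDerivAt_integral_of_dominated_loc_of_deriv_le (bound := fun _ => C)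
    (Metric.closedBall_mem_nhds t one_pos) (.of_forall fun s => (hf s).aestronglyMeasurable)
    ((hf t).integrable_of_isCompact_of_compl_null hK hμ)
    (hf'.comp (Continuous.prodMk_right t)).aestronglyMeasurable ?_ (integrable_const C)
    (.of_forall fun x s _ => hderiv s x)).2
  filter_upwards [(hμ : ∀ᵐ x ∂μ, x ∈ K)] with x hx s hs
  exact hC (s, x) ⟨hs, hx⟩

end CompactSupport

/-- A trace identity for the generators `x ↦ ⟪e i, x⟫ • e j - ⟪e j, x⟫ • e i` of the rotations. -/
theorem OrthonormalBasis.sum_rotation_generators {E κ : Type*} [NormedAddCommGroup E]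
    [InnerProductSpace ℝ E] [Fintype κ] (e : OrthonormalBasis κ ℝ E) (T : E →L[ℝ] E)
    (v x : E) (r : ℝ) (hx : ‖x‖ = 1) :
    ∑ i, ∑ j, (⟪r • T (⟪e i, x⟫ • e j - ⟪e j, x⟫ • e i), e j⟫ * ⟪x, e i⟫ +
      ⟪v, e j⟫ * ⟪⟪e i, x⟫ • e j - ⟪e j, x⟫ • e i, e i⟫) =
    r * LinearMap.trace ℝ E (T : E →ₗ[ℝ] E) - r * ⟪T x, x⟫
      - (Module.finrank ℝ E - 1) * ⟪v, x⟫ := by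
  classical
  have h1 : ∑ i, ⟪x, e i⟫ * ⟪e i, x⟫ = 1 := by
    rw [e.sum_inner_mul_inner, real_inner_self_eq_norm_sq, hx, one_pow]
  have h2 : ∑ j, ⟪v, e j⟫ * ⟪e j, x⟫ = ⟪v, x⟫ := e.sum_inner_mul_inner v x
  have h3 : ∑ i, (∑ j, ⟪T (e i), e j⟫ * ⟪e j, x⟫) * ⟪e i, x⟫ = ⟪T x, x⟫ := by
    have hTx : T x = ∑ i, ⟪e i, x⟫ • T (e i) := by
      conv_lhs => rw [← e.sum_repr' x]
      simp only [map_sum, map_smul]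
    simp_rw [e.sum_inner_mul_inner, hTx, sum_inner, real_inner_smul_left, mul_comm]
  have h4 : LinearMap.trace ℝ E (T : E →ₗ[ℝ] E) = ∑ j, ⟪T (e j), e j⟫ := by
    rw [LinearMap.trace_eq_sum_inner _ e]
    exact Finset.sum_congr rfl fun j _ => real_inner_comm _ _
  have key (i j : κ) : ⟪r • T (⟪e i, x⟫ • e j - ⟪e j, x⟫ • e i), e j⟫ * ⟪x, e i⟫ +
      ⟪v, e j⟫ * ⟪⟪e i, x⟫ • e j - ⟪e j, x⟫ • e i, e i⟫ =
      r * ((⟪x, e i⟫ * ⟪e i, x⟫) * ⟪T (e j), e j⟫) -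
      r * (⟪T (e i), e j⟫ * ⟪e j, x⟫ * ⟪e i, x⟫) +
      (if j = i then ⟪v, e j⟫ * ⟪e i, x⟫ else 0) - ⟪v, e j⟫ * ⟪e j, x⟫ := by
    simp only [map_sub, map_smul, inner_sub_left, real_inner_smul_left,
      orthonormal_iff_ite.1 e.orthonormal, real_inner_comm (e i) x]
    split_ifs <;> simp <;> ring
  simp only [key, Finset.sum_add_distrib, Finset.sum_sub_distrib, ← Finset.mul_sum,
    ← Finset.sum_mul, h1, h2, h3, h4, Finset.sum_ite_eq', Finset.mem_univ, if_true,
    Finset.sum_const, Finset.card_univ, Module.finrank_eq_card_basis e.toBasis]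
  simp only [nsmul_eq_mul, one_mul]
  ring

section RotationInvariant

variable {E : Type*} [NormedAddCommGroup E] [InnerProductSpace ℝ E] [FiniteDimensional ℝ E]
  [MeasurableSpace E] [BorelSpace E] {σ : Measure E} [IsFiniteMeasure σ]

/-- Infinitesimal rotations integrate to zero against a rotation-invariant measure carried by a
compact set. -/
theorem integral_fderiv_apply_skew_eq_zero {K : Set E} (hK : IsCompact K) (hσ : σ Kᶜ = 0)
    (hσinv : ∀ O : E ≃ₗᵢ[ℝ] E, Measure.map (⇑O) σ = σ) {A : E →L[ℝ] E}
    (hA : ∀ x y, ⟪A x, y⟫ = -⟪x, A y⟫) {f : E → ℝ} (hf : ContDiff ℝ 1 f) :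
    ∫ x, fderiv ℝ f x (A x) ∂σ = 0 := by
  have hA' : A ∈ skewAdjoint (E →L[ℝ] E) := by
    rw [skewAdjoint.mem_iff, ContinuousLinearMap.star_eq_adjoint, eq_comm,
      ContinuousLinearMap.eq_adjoint_iff]
    intro x y
    simp [hA x y]
  let U : ℝ → E →L[ℝ] E := fun t => NormedSpace.exp (t • A)
  have hU (t : ℝ) : HasDerivAt U (A * U t) t := hasDerivAt_exp_smul_const' A t
  have hUc : Continuous U := continuous_iff_continuousAt.2 fun t => (hU t).continuousAt
  have hUx : Continuous fun p : ℝ × E => U p.1 p.2 :=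
    (hUc.comp continuous_fst).clm_apply continuous_snd
  have hconst (t : ℝ) : ∫ x, f (U t x) ∂σ = ∫ x, f x ∂σ := by
    let _ : NormedAlgebra ℚ (E →L[ℝ] E) := NormedAlgebra.restrictScalars ℚ ℝ _
    have hmem : U t ∈ unitary (E →L[ℝ] E) :=
      NormedSpace.exp_mem_unitary_of_mem_skewAdjoint (skewAdjoint.smul_mem t hA')
    let O : E ≃ₗᵢ[ℝ] E := Unitary.linearIsometryEquiv ⟨U t, hmem⟩
    have hmap := O.toHomeomorph.toMeasurableEquiv.measurableEmbedding.integral_map (μ := σ) f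
    exact hmap.symm.trans (congrArg (fun ν => ∫ x, f x ∂ν) (hσinv O))
  have hd := hasDerivAt_integral_of_isCompact_of_compl_null (μ := σ) (f := fun t x => f (U t x))
    (f' := fun t x => fderiv ℝ f (U t x) (A (U t x))) hK hσ
    (fun t => hf.continuous.comp (U t).continuous)
    (((hf.continuous_fderiv one_ne_zero).comp hUx).clm_apply (A.continuous.comp hUx))
    (fun t x => ((hf.differentiable one_ne_zero) (U t x)).hasFDerivAt.comp_hasDerivAt t
      ((hU t).clm_apply (hasDerivAt_const t x) |>.congr_deriv (by simp))) 0
  simp only [hconst] at hd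
  simpa [U] using hd.unique (hasDerivAt_const _ _)

/-- The flux of a divergence-free field through a centred sphere vanishes. -/
theorem integral_inner_eq_zero_of_trace_fderiv_eq_zero (hE : 2 ≤ Module.finrank ℝ E)
    (hσ : σ (Metric.sphere (0 : E) 1)ᶜ = 0)
    (hσinv : ∀ O : E ≃ₗᵢ[ℝ] E, Measure.map (⇑O) σ = σ) {F : E → E} (hF : ContDiff ℝ 1 F)
    (hdiv : ∀ x, LinearMap.trace ℝ E (fderiv ℝ F x : E →ₗ[ℝ] E) = 0) {ρ : ℝ} (hρ : 0 < ρ) :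
    ∫ x, ⟪F (ρ • x), x⟫ ∂σ = 0 := by
  have hK : IsCompact (Metric.sphere (0 : E) 1) := isCompact_sphere 0 1
  have hFd (y : E) : HasFDerivAt F (fderiv ℝ F y) y :=
    (hF.differentiable one_ne_zero y).hasFDerivAt
  have hF' : Continuous (fderiv ℝ F) := hF.continuous_fderiv one_ne_zero
  have hFr (r : ℝ) : Continuous fun x => F (r • x) := hF.continuous.comp (continuous_const_smul r)
  let g : ℝ → ℝ := fun r => ∫ x, ⟪F (r • x), x⟫ ∂σ
  let g' : ℝ → ℝ := fun r => ∫ x, ⟪fderiv ℝ F (r • x) x, x⟫ ∂σ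
  have hg (r : ℝ) : HasDerivAt g (g' r) r := by
    refine hasDerivAt_integral_of_isCompact_of_compl_null hK hσ
      (f := fun r x => ⟪F (r • x), x⟫) (f' := fun r x => ⟪fderiv ℝ F (r • x) x, x⟫)
      (fun s => (hFr s).inner continuous_id)
      (((hF'.comp continuous_smul).clm_apply continuous_snd).inner continuous_snd)
      (fun s x => ?_) r
    have h1 : HasDerivAt (fun s : ℝ => s • x) x s := by
      simpa using (hasDerivAt_id s).smul_const x
    simpa using ((hFd (s • x)).comp_hasDerivAt s h1).inner ℝ (hasDerivAt_const s x)
  have hode (r : ℝ) : r * g' r + (Module.finrank ℝ E - 1) * g r = 0 := by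
    let e := stdOrthonormalBasis ℝ E
    let A (i j : Fin (Module.finrank ℝ E)) : E →L[ℝ] E :=
      (innerSL ℝ (e i)).smulRight (e j) - (innerSL ℝ (e j)).smulRight (e i)
    have hA (i j) (x : E) : A i j x = ⟪e i, x⟫ • e j - ⟪e j, x⟫ • e i := by simp [A]
    let f (i j : Fin (Module.finrank ℝ E)) : E → ℝ := fun x => ⟪F (r • x), e j⟫ * ⟪x, e i⟫
    have hf (i j) : ContDiff ℝ 1 (f i j) :=
      ((hF.comp (contDiff_const_smul r)).inner ℝ contDiff_const).mul
        (contDiff_id.inner ℝ contDiff_const)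
    have hfd (i j) (x w : E) : fderiv ℝ (f i j) x w =
        ⟪r • fderiv ℝ F (r • x) w, e j⟫ * ⟪x, e i⟫ + ⟪F (r • x), e j⟫ * ⟪w, e i⟫ := by
      have h1 : HasFDerivAt (fun x : E => F (r • x))
          ((fderiv ℝ F (r • x)).comp (r • ContinuousLinearMap.id ℝ E)) x :=
        (hFd (r • x)).comp x ((hasFDerivAt_id x).const_smul r)
      have h2 := (h1.inner ℝ (hasFDerivAt_const (e j) x)).mul
        ((hasFDerivAt_id x).inner ℝ (hasFDerivAt_const (e i) x))
      change HasFDerivAt (f i j) _ x at h2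
      rw [h2.fderiv]
      simp [real_inner_smul_left]
      ring
    have hz (i j) : ∫ x, fderiv ℝ (f i j) x (A i j x) ∂σ = 0 := by
      refine integral_fderiv_apply_skew_eq_zero hK hσ hσinv (fun x y => ?_) (hf i j)
      simp only [hA, inner_sub_left, inner_sub_right, real_inner_smul_left,
        real_inner_smul_right, real_inner_comm x]
      ring
    have hint (i j) : Integrable (fun x => fderiv ℝ (f i j) x (A i j x)) σ :=
      (((hf i j).continuous_fderiv one_ne_zero).clm_apply
        (A i j).continuous).integrable_of_isCompact_of_compl_null hK hσ
    have hsum : ∫ x, ∑ i, ∑ j, fderiv ℝ (f i j) x (A i j x) ∂σ = 0 := by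
      rw [integral_finsetSum _ fun i _ => integrable_finsetSum _ fun j _ => hint i j]
      refine Finset.sum_eq_zero fun i _ => ?_
      rw [integral_finsetSum _ fun j _ => hint i j]
      exact Finset.sum_eq_zero fun j _ => hz i j
    have hae : ∀ᵐ x ∂σ, ∑ i, ∑ j, fderiv ℝ (f i j) x (A i j x) =
        -(r * ⟪fderiv ℝ F (r • x) x, x⟫ + (Module.finrank ℝ E - 1) * ⟪F (r • x), x⟫) := by
      filter_upwards [(hσ : ∀ᵐ x ∂σ, x ∈ Metric.sphere (0 : E) 1)] with x hx
      simp only [hfd, hA]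
      rw [e.sum_rotation_generators _ _ _ _ (by simpa using hx), hdiv]
      ring
    rw [integral_congr_ae hae, integral_neg, neg_eq_zero, integral_add, integral_const_mul,
      integral_const_mul] at hsum
    · exact hsum
    · exact ((((hF'.comp (continuous_const_smul r)).clm_apply continuous_id).inner
        continuous_id).integrable_of_isCompact_of_compl_null hK hσ).const_mul _
    · exact (((hFr r).inner continuous_id).integrable_of_isCompact_of_compl_null hK hσ).const_mul _
  obtain ⟨n, hn⟩ : ∃ n, Module.finrank ℝ E = n + 2 := ⟨_, (Nat.sub_add_cancel hE).symm⟩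
  have hderiv (r : ℝ) : HasDerivAt (fun r => r ^ (n + 1) * g r) 0 r := by
    refine ((hasDerivAt_pow (n + 1) r).mul (hg r)).congr_deriv ?_
    have := hode r
    rw [hn] at this
    push_cast at this ⊢
    linear_combination r ^ n * this
  have hconst := is_const_of_deriv_eq_zero (fun r => (hderiv r).differentiableAt)
    (fun r => (hderiv r).deriv) ρ 0
  simpa [hρ.ne'] using hconst

end RotationInvariant

/-- Let `σ` be the uniform (rotation-invariant) probability measure on the
unit sphere of `ℝ^d`, and let `(H, ι, k)` be an RKHS of vector fields on `ℝ^d` whose kernel is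
translation invariant with covariance tensor `b`.  If every vector field `ι V` (`V ∈ H`) is
continuously differentiable and divergence free on `ℝ^d`, then for every `ρ > 0`,
`∫∫ ⟪b(ρθ − ρφ)θ, φ⟫ dσ(θ) dσ(φ) = 0`. -/
theorem statement8 (d : ℕ) (hd : 2 ≤ d)
    (σ : Measure (EuclideanSpace ℝ (Fin d))) [IsProbabilityMeasure σ]
    (hσsphere : σ (Metric.sphere (0 : EuclideanSpace ℝ (Fin d)) 1)ᶜ = 0)
    (hσinv : ∀ O : EuclideanSpace ℝ (Fin d) ≃ₗᵢ[ℝ] EuclideanSpace ℝ (Fin d),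
      Measure.map (⇑O) σ = σ)
    (H : Type*) [NormedAddCommGroup H] [InnerProductSpace ℝ H] [CompleteSpace H]
    (ι : H →ₗ[ℝ] (EuclideanSpace ℝ (Fin d) → EuclideanSpace ℝ (Fin d)))
    (hι : Function.Injective ι)
    (k : EuclideanSpace ℝ (Fin d) → EuclideanSpace ℝ (Fin d) → H)
    (hk : Continuous fun p : EuclideanSpace ℝ (Fin d) × EuclideanSpace ℝ (Fin d) =>
      k p.1 p.2)
    (hrep : ∀ (f : H) (x ξ : EuclideanSpace ℝ (Fin d)), ⟪f, k x ξ⟫ = ⟪ι f x, ξ⟫)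
    (b : EuclideanSpace ℝ (Fin d) →
      (EuclideanSpace ℝ (Fin d) →L[ℝ] EuclideanSpace ℝ (Fin d)))
    (hbcont : Continuous b)
    (htransl : ∀ x ξ y : EuclideanSpace ℝ (Fin d), ι (k x ξ) y = b (x - y) ξ)
    (hdivfree : ∀ V : H, ContDiff ℝ 1 (ι V) ∧
      ∀ x : EuclideanSpace ℝ (Fin d), LinearMap.trace ℝ (EuclideanSpace ℝ (Fin d))
        (fderiv ℝ (ι V) x : EuclideanSpace ℝ (Fin d) →ₗ[ℝ] EuclideanSpace ℝ (Fin d)) = 0) :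
    ∀ ρ : ℝ, 0 < ρ →
      ∫ φ, ∫ θ, ⟪b (ρ • θ - ρ • φ) θ, φ⟫ ∂σ ∂σ = 0 := by
  intro ρ hρ
  have hK : IsCompact (Metric.sphere (0 : EuclideanSpace ℝ (Fin d)) 1) := isCompact_sphere 0 1
  have hint : Integrable (fun θ => k (ρ • θ) θ) σ :=
    (hk.comp ((continuous_const_smul ρ).prodMk
      continuous_id)).integrable_of_isCompact_of_compl_null hK hσsphere
  have hinner (φ : EuclideanSpace ℝ (Fin d)) : ∫ θ, ⟪b (ρ • θ - ρ • φ) θ, φ⟫ ∂σ =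
      ⟪ι (∫ θ, k (ρ • θ) θ ∂σ) (ρ • φ), φ⟫ := by
    simp_rw [← htransl, ← hrep]
    rw [real_inner_comm, ← integral_inner hint]
    simp_rw [real_inner_comm]
  simp_rw [hinner]
  obtain ⟨hV, hdiv⟩ := hdivfree (∫ θ, k (ρ • θ) θ ∂σ)
  exact integral_inner_eq_zero_of_trace_fderiv_eq_zero (by simpa using hd) hσsphere hσinv hV hdiv hρ
end

section
/- Let V : ℝ^d → ℝ^d be continuous, let α > 0 and 0 < u₁ < u₂, and suppose ⟨V(x), x⟩ ≤ −α for every x ∈ ℝ^d with u₁ ≤ ‖x‖ ≤ u₂. Let ξ : [0,∞) → ℝ^d be differentiable with ξ'(t) = V(ξ(t)) for all t ≥ 0. If u ∈ [u₁, u₂] and ‖ξ(0)‖ ≤ u, then ‖ξ(t)‖ ≤ u for all t ≥ 0; in other words, every closed ball centered at the origin with radius in [u₁, u₂] is forward invariant under solutions of the ODE ξ' = V(ξ). -/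
open RealInnerProductSpace

/-- Let `V : ℝ^d → ℝ^d` be continuous with `⟪V(x), x⟫ ≤ −α` (for some
`α > 0`) whenever `u₁ ≤ ‖x‖ ≤ u₂` (where `0 < u₁ < u₂`).  If `ξ : [0,∞) → ℝ^d` solves
`ξ' = V(ξ)` and `u ∈ [u₁, u₂]` with `‖ξ(0)‖ ≤ u`, then `‖ξ(t)‖ ≤ u` for all `t ≥ 0`:
every closed ball centered at the origin with radius in `[u₁, u₂]` is forward invariant. -/
theorem statement9 (d : ℕ) (hd : 1 ≤ d)
    (V : EuclideanSpace ℝ (Fin d) → EuclideanSpace ℝ (Fin d)) (hV : Continuous V)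
    (α u₁ u₂ : ℝ) (hα : 0 < α) (hu₁ : 0 < u₁) (hu₁₂ : u₁ < u₂)
    (hin : ∀ x : EuclideanSpace ℝ (Fin d), u₁ ≤ ‖x‖ → ‖x‖ ≤ u₂ → ⟪V x, x⟫ ≤ -α)
    (ξ : ℝ → EuclideanSpace ℝ (Fin d))
    (hξ : ∀ t : ℝ, 0 ≤ t → HasDerivWithinAt ξ (V (ξ t)) (Set.Ici 0) t)
    (u : ℝ) (hu : u ∈ Set.Icc u₁ u₂) (h0 : ‖ξ 0‖ ≤ u) :
    ∀ t : ℝ, 0 ≤ t → ‖ξ t‖ ≤ u := by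
  intro t ht
  have hsq : ∀ s, 0 ≤ s →
      HasDerivWithinAt (fun r => ‖ξ r‖ ^ 2) (2 * ⟪ξ s, V (ξ s)⟫) (Set.Ici 0) s :=
    fun s hs => (hξ s hs).norm_sq
  have hu0 : 0 ≤ u := hu₁.le.trans hu.1
  have key : ‖ξ t‖ ^ 2 ≤ u ^ 2 := by
    refine image_le_of_deriv_right_lt_deriv_boundary (f := fun r => ‖ξ r‖ ^ 2)
      (f' := fun s => 2 * ⟪ξ s, V (ξ s)⟫) (B := fun _ => u ^ 2) (B' := fun _ => 0)
      (a := 0) (b := t) (fun s hs => (hsq s hs.1).continuousWithinAt.mono Set.Icc_subset_Ici_self)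
      (fun s hs => (hsq s hs.1).mono (Set.Ici_subset_Ici.2 hs.1))
      (pow_le_pow_left₀ (norm_nonneg _) h0 2) (fun s => hasDerivAt_const s _) ?_ ⟨ht, le_rfl⟩
    intro s _ hs
    have hnorm : ‖ξ s‖ = u := (pow_left_inj₀ (norm_nonneg _) hu0 two_ne_zero).1 hs
    have hinner := hin (ξ s) (hnorm ▸ hu.1) (hnorm ▸ hu.2)
    rw [real_inner_comm] at hinner
    linarith
  exact (pow_le_pow_iff_left₀ (norm_nonneg _) hu0 two_ne_zero).1 key
end

section
/- Let V : ℝ^d → ℝ^d be continuous, let α > 0 and 0 < u₁ < u₂, and suppose ⟨V(x), x⟩ ≤ −α for every x ∈ ℝ^d with u₁ ≤ ‖x‖ ≤ u₂. Let ξ : [0,∞) → ℝ^d be differentiable with ξ'(t) = V(ξ(t)) for all t ≥ 0 and ‖ξ(0)‖ ≤ u₂. Then ‖ξ(t)‖ ≤ u₁ for every t ≥ (u₂² − u₁²)/(2α); in other words, solutions of the ODE ξ' = V(ξ) starting in the closed ball of radius u₂ enter the closed ball of radius u₁ by time (u₂² − u₁²)/(2α) and remain there afterwards. -/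
open RealInnerProductSpace

/-- Let `V : ℝ^d → ℝ^d` be continuous with `⟪V(x), x⟫ ≤ −α` (for some
`α > 0`) whenever `u₁ ≤ ‖x‖ ≤ u₂` (where `0 < u₁ < u₂`).  If `ξ : [0,∞) → ℝ^d` solves
`ξ' = V(ξ)` with `‖ξ(0)‖ ≤ u₂`, then `‖ξ(t)‖ ≤ u₁` for every `t ≥ (u₂² − u₁²)/(2α)`. -/
theorem statement10 (d : ℕ) (hd : 1 ≤ d)
    (V : EuclideanSpace ℝ (Fin d) → EuclideanSpace ℝ (Fin d)) (hV : Continuous V)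
    (α u₁ u₂ : ℝ) (hα : 0 < α) (hu₁ : 0 < u₁) (hu₁₂ : u₁ < u₂)
    (hin : ∀ x : EuclideanSpace ℝ (Fin d), u₁ ≤ ‖x‖ → ‖x‖ ≤ u₂ → ⟪V x, x⟫ ≤ -α)
    (ξ : ℝ → EuclideanSpace ℝ (Fin d))
    (hξ : ∀ t : ℝ, 0 ≤ t → HasDerivWithinAt ξ (V (ξ t)) (Set.Ici 0) t)
    (h0 : ‖ξ 0‖ ≤ u₂) :
    ∀ t : ℝ, (u₂ ^ 2 - u₁ ^ 2) / (2 * α) ≤ t → ‖ξ t‖ ≤ u₁ := by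
  have hf (t : ℝ) (ht : 0 ≤ t) :
      HasDerivWithinAt (fun s => ‖ξ s‖ ^ 2) (2 * ⟪ξ t, V (ξ t)⟫) (Set.Ici 0) t :=
    (hξ t ht).norm_sq
  have hT : 0 < (u₂ ^ 2 - u₁ ^ 2) / (2 * α) := by
    have : u₁ ^ 2 < u₂ ^ 2 := by gcongr
    have : 0 < u₂ ^ 2 - u₁ ^ 2 := by linarith
    positivity
  -- Strictly after the critical time, compare `‖ξ‖²` with the affine function
  -- going from `u₂²` at time `0` to `u₁²` at time `t`.
  have key (t : ℝ) (ht : (u₂ ^ 2 - u₁ ^ 2) / (2 * α) < t) : ‖ξ t‖ ^ 2 ≤ u₁ ^ 2 := by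
    have ht0 : 0 < t := hT.trans ht
    set c : ℝ := (u₂ ^ 2 - u₁ ^ 2) / t with hc
    have hct : c * t = u₂ ^ 2 - u₁ ^ 2 := div_mul_cancel₀ _ ht0.ne'
    have hc0 : 0 < c := by
      have : u₁ ^ 2 < u₂ ^ 2 := by gcongr
      exact div_pos (by linarith) ht0
    have hcα : c < 2 * α := by
      rw [div_lt_iff₀ (by positivity)] at ht
      rw [hc, div_lt_iff₀ ht0]
      linarith
    have hB (s : ℝ) : HasDerivAt (fun s => u₂ ^ 2 - c * s) (-c) s := by
      simpa using ((hasDerivAt_id s).const_mul c).const_sub (u₂ ^ 2)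
    have h := image_le_of_deriv_right_lt_deriv_boundary (a := 0) (b := t)
      (f := fun s => ‖ξ s‖ ^ 2) (f' := fun s => 2 * ⟪ξ s, V (ξ s)⟫)
      (B := fun s => u₂ ^ 2 - c * s) (B' := fun _ => -c)
      (fun s hs => ((hf s hs.1).continuousWithinAt).mono Set.Icc_subset_Ici_self)
      (fun s hs => (hf s hs.1).mono (Set.Ici_subset_Ici.2 hs.1))
      (by simpa using pow_le_pow_left₀ (norm_nonneg _) h0 2) hB
      (fun s hs heq => by
        have h1 : c * s ≤ c * t := by gcongr; exact hs.2.le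
        have h2 : 0 ≤ c * s := mul_nonneg hc0.le hs.1
        have hlow : u₁ ≤ ‖ξ s‖ := by
          refine le_of_pow_le_pow_left₀ two_ne_zero (norm_nonneg _) ?_
          linarith
        have hupp : ‖ξ s‖ ≤ u₂ := by
          refine le_of_pow_le_pow_left₀ two_ne_zero (hu₁.trans hu₁₂).le ?_
          linarith
        have h3 := hin (ξ s) hlow hupp
        rw [real_inner_comm] at h3
        linarith)
      (Set.right_mem_Icc.2 ht0.le)
    linarith
  intro t ht
  refine le_of_pow_le_pow_left₀ two_ne_zero hu₁.le ?_
  have hlim : Filter.Tendsto (fun s => ‖ξ s‖ ^ 2) (nhdsWithin t (Set.Ioi t))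
      (nhds (‖ξ t‖ ^ 2)) :=
    (hf t (hT.le.trans ht)).continuousWithinAt.mono
      (Set.Ioi_subset_Ici (hT.le.trans ht))
  exact le_of_tendsto hlim
    (Filter.eventually_of_mem self_mem_nhdsWithin fun s hs => key s (ht.trans_lt hs))
end
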